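/- arXiv:2306.01852 — 8 statements merged into one kernel-verified Lean document; each statement's English description precedes it below -/
import Mathlib

section
/- Let μ > 0, let u : [0,1] → ℝ be continuously differentiable with u(0) = 0, and let v : [0,1] → ℝ be continuous. Then ∫₀¹ [e^{μx}(u'(x)+v(x))² + e^{−μx}(u'(x)−v(x))²] dx ≥ 2 e^{−μ} |u(1)|²; equivalently, −μ ∫₀¹ [e^{μx}(u'(x)+v(x))² + e^{−μx}(u'(x)−v(x))²] dx ≤ −2 μ e^{−μ} |u(1)|². -/
/-- For `x ≤ 1` the weights are bounded below by `e^{−μ}`, and `a² ≥ 2ca − c²`. -/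
lemma weighted_energy_density_lower_bound {μ x : ℝ} (hμ : 0 ≤ μ) (hx : x ∈ Set.Icc (0:ℝ) 1)
    (a b c : ℝ) :
    2 * Real.exp (-μ) * (2 * c * a - c ^ 2) ≤
      Real.exp (μ * x) * (a + b) ^ 2 + Real.exp (-μ * x) * (a - b) ^ 2 := by
  have h1 : Real.exp (-μ) ≤ Real.exp (μ * x) :=
    Real.exp_le_exp.2 (by nlinarith [mul_nonneg hμ hx.1])
  have h2 : Real.exp (-μ) ≤ Real.exp (-μ * x) :=
    Real.exp_le_exp.2 (by nlinarith [mul_le_mul_of_nonneg_left hx.2 hμ])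
  calc 2 * Real.exp (-μ) * (2 * c * a - c ^ 2)
      ≤ 2 * Real.exp (-μ) * (a ^ 2 + b ^ 2) := by
        gcongr
        nlinarith [sq_nonneg (a - c), sq_nonneg b]
    _ = Real.exp (-μ) * (a + b) ^ 2 + Real.exp (-μ) * (a - b) ^ 2 := by ring
    _ ≤ _ := by gcongr

/-- Weighted trace estimate: for `μ > 0`, `u` continuously differentiable with `u 0 = 0`
and `v` continuous on `[0,1]`,
`∫₀¹ [e^{μx}(u'+v)² + e^{−μx}(u'−v)²] dx ≥ 2 e^{−μ} |u 1|²`; equivalently,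
`−μ ∫₀¹ [e^{μx}(u'+v)² + e^{−μx}(u'−v)²] dx ≤ −2 μ e^{−μ} |u 1|²`. -/
theorem stmt_2 (μ : ℝ) (hμ : 0 < μ) (u u' v : ℝ → ℝ)
    (hderiv : ∀ x ∈ Set.Icc (0:ℝ) 1, HasDerivAt u (u' x) x)
    (hcont : ContinuousOn u' (Set.Icc 0 1))
    (hv : ContinuousOn v (Set.Icc 0 1))
    (h0 : u 0 = 0) :
    (∫ x in (0:ℝ)..1,
        (Real.exp (μ * x) * (u' x + v x) ^ 2 + Real.exp (-μ * x) * (u' x - v x) ^ 2))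
      ≥ 2 * Real.exp (-μ) * |u 1| ^ 2 ∧
    -μ * ∫ x in (0:ℝ)..1,
        (Real.exp (μ * x) * (u' x + v x) ^ 2 + Real.exp (-μ * x) * (u' x - v x) ^ 2)
      ≤ -(2 * μ * Real.exp (-μ)) * |u 1| ^ 2 := by
  have key : 2 * Real.exp (-μ) * |u 1| ^ 2 ≤ ∫ x in (0:ℝ)..1,
      (Real.exp (μ * x) * (u' x + v x) ^ 2 + Real.exp (-μ * x) * (u' x - v x) ^ 2) := by
    have hu' : IntervalIntegrable u' MeasureTheory.volume 0 1 :=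
      hcont.intervalIntegrable_of_Icc zero_le_one
    have hFTC : ∫ x in (0:ℝ)..1, u' x = u 1 := by
      rw [intervalIntegral.integral_eq_sub_of_hasDerivAt
        (by rwa [Set.uIcc_of_le zero_le_one]) hu', h0, sub_zero]
    have hlin : IntervalIntegrable (fun x => 2 * u 1 * u' x) MeasureTheory.volume 0 1 := hu'.const_mul _
    have hconst : IntervalIntegrable (fun _ => u 1 ^ 2) MeasureTheory.volume (0:ℝ) 1 :=
      intervalIntegrable_const
    calc 2 * Real.exp (-μ) * |u 1| ^ 2
        = ∫ x in (0:ℝ)..1, 2 * Real.exp (-μ) * (2 * u 1 * u' x - u 1 ^ 2) := by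
          rw [intervalIntegral.integral_const_mul, intervalIntegral.integral_sub hlin hconst,
            intervalIntegral.integral_const_mul, hFTC, intervalIntegral.integral_const,
            sq_abs, smul_eq_mul]
          ring
      _ ≤ _ := by
          refine intervalIntegral.integral_mono_on zero_le_one
            ((hlin.sub hconst).const_mul _) (ContinuousOn.intervalIntegrable_of_Icc zero_le_one
              (by fun_prop)) fun x hx => weighted_energy_density_lower_bound hμ.le hx _ _ _
  exact ⟨key, by nlinarith [mul_le_mul_of_nonneg_left key hμ.le]⟩
end

section
/- Let k be a real number with |k| < 1 and let φ : [0,1] → ℝ be continuously differentiable with φ(0) = 0. Then ∫₀¹ φ'(x)² dx − k·φ(1)² ≥ (1−|k|) ∫₀¹ φ'(x)² dx, and consequently ∫₀¹ φ'(x)² dx − k·φ(1)² ≥ ((1−|k|)π²/(π²+4)) (∫₀¹ φ(x)² dx + ∫₀¹ φ'(x)² dx). -/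
open Set Filter Topology intervalIntegral

/-- If `φ 0 = 0`, then `φ(1)² ≤ ∫₀¹ φ'²`. -/
theorem sq_apply_one_le_integral_deriv_sq {φ φ' : ℝ → ℝ}
    (hderiv : ∀ x ∈ Icc (0:ℝ) 1, HasDerivAt φ (φ' x) x)
    (hcont : ContinuousOn φ' (Icc 0 1)) (h0 : φ 0 = 0) :
    φ 1 ^ 2 ≤ ∫ x in (0:ℝ)..1, φ' x ^ 2 := by
  have huIcc : uIcc (0:ℝ) 1 = Icc 0 1 := uIcc_of_le zero_le_one
  have hint : IntervalIntegrable φ' MeasureTheory.volume 0 1 :=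
    ContinuousOn.intervalIntegrable (huIcc ▸ hcont)
  have hint_sq : IntervalIntegrable (fun x => φ' x ^ 2) MeasureTheory.volume 0 1 :=
    ContinuousOn.intervalIntegrable (huIcc ▸ hcont.pow 2)
  have hftc : ∫ x in (0:ℝ)..1, φ' x = φ 1 := by
    rw [integral_eq_sub_of_hasDerivAt (fun x hx => hderiv x (huIcc ▸ hx)) hint, h0, sub_zero]
  have hmono : ∫ x in (0:ℝ)..1, (2 * φ 1 * φ' x - φ 1 ^ 2) ≤ ∫ x in (0:ℝ)..1, φ' x ^ 2 :=
    integral_mono_on zero_le_one ((hint.const_mul _).sub intervalIntegrable_const) hint_sq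
      fun x _ => by linarith [sq_nonneg (φ' x - φ 1)]
  rw [integral_sub (hint.const_mul _) intervalIntegrable_const, integral_const_mul, hftc,
    integral_const, sub_zero, one_smul] at hmono
  linarith

/-- Poincaré inequality on `[0, 1]` with a Dirichlet condition at `0`, for every constant below
the optimal one. -/
theorem sq_mul_integral_sq_le_integral_deriv_sq_of_lt {φ φ' : ℝ → ℝ} {c : ℝ}
    (hc0 : 0 ≤ c) (hc : c < Real.pi / 2)
    (hderiv : ∀ x ∈ Icc (0:ℝ) 1, HasDerivAt φ (φ' x) x)
    (hcont : ContinuousOn φ' (Icc 0 1)) (h0 : φ 0 = 0) :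
    c ^ 2 * ∫ x in (0:ℝ)..1, φ x ^ 2 ≤ ∫ x in (0:ℝ)..1, φ' x ^ 2 := by
  have huIcc : uIcc (0:ℝ) 1 = Icc 0 1 := uIcc_of_le zero_le_one
  have hφ : ContinuousOn φ (Icc 0 1) := fun x hx => (hderiv x hx).continuousAt.continuousWithinAt
  set g : ℝ → ℝ := fun x => c * Real.tan (c * (1 - x)) with hg
  have hg_deriv : ∀ x ∈ Icc (0:ℝ) 1, HasDerivAt g (-c ^ 2 - g x ^ 2) x := by
    intro x hx
    have hcos : Real.cos (c * (1 - x)) ≠ 0 := by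
      refine (Real.cos_pos_of_mem_Ioo ⟨?_, ?_⟩).ne'
      · nlinarith [hx.1, hx.2, Real.pi_pos]
      · nlinarith [hx.1, hx.2]
    have harg : HasDerivAt (fun y : ℝ => c * (1 - y)) (c * (-1)) x :=
      ((hasDerivAt_id x).const_sub 1).const_mul c
    refine (((Real.hasDerivAt_tan hcos).comp x harg).const_mul c).congr_deriv ?_
    have htan : 1 / Real.cos (c * (1 - x)) ^ 2 = 1 + Real.tan (c * (1 - x)) ^ 2 := by
      rw [← Real.inv_one_add_tan_sq hcos, one_div, inv_inv]
    rw [htan]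
    simp only [hg]
    ring
  have hg_cont : ContinuousOn g (Icc 0 1) :=
    fun x hx => (hg_deriv x hx).continuousAt.continuousWithinAt
  have hprod : ∀ x ∈ Icc (0:ℝ) 1, HasDerivAt (fun y => g y * φ y ^ 2)
      ((-c ^ 2 - g x ^ 2) * φ x ^ 2 + g x * (2 * φ x * φ' x)) x := fun x hx =>
    ((hg_deriv x hx).mul ((hderiv x hx).pow 2)).congr_deriv (by simp)
  have hint : IntervalIntegrable
      (fun x => (-c ^ 2 - g x ^ 2) * φ x ^ 2 + g x * (2 * φ x * φ' x))
      MeasureTheory.volume 0 1 := by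
    refine ContinuousOn.intervalIntegrable (huIcc ▸ ?_)
    fun_prop
  have hint_φ : IntervalIntegrable (fun x => φ x ^ 2) MeasureTheory.volume 0 1 :=
    ContinuousOn.intervalIntegrable (huIcc ▸ hφ.pow 2)
  have hint_φ' : IntervalIntegrable (fun x => φ' x ^ 2) MeasureTheory.volume 0 1 :=
    ContinuousOn.intervalIntegrable (huIcc ▸ hcont.pow 2)
  have hftc := integral_eq_sub_of_hasDerivAt (fun x hx => hprod x (huIcc ▸ hx)) hint
  have hmono := integral_mono_on zero_le_one hint (hint_φ'.sub (hint_φ.const_mul (c ^ 2)))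
    fun x _ => by linarith [sq_nonneg (φ' x - g x * φ x)]
  rw [hftc, integral_sub hint_φ' (hint_φ.const_mul _), integral_const_mul] at hmono
  simp only [hg, h0, sub_self, mul_zero, Real.tan_zero, zero_mul, ne_eq, OfNat.ofNat_ne_zero,
    not_false_eq_true, zero_pow] at hmono
  linarith

/-- Poincaré inequality on `[0, 1]` with a Dirichlet condition at `0` and the optimal constant. -/
theorem pi_div_two_sq_mul_integral_sq_le_integral_deriv_sq {φ φ' : ℝ → ℝ}
    (hderiv : ∀ x ∈ Icc (0:ℝ) 1, HasDerivAt φ (φ' x) x)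
    (hcont : ContinuousOn φ' (Icc 0 1)) (h0 : φ 0 = 0) :
    (Real.pi / 2) ^ 2 * ∫ x in (0:ℝ)..1, φ x ^ 2 ≤ ∫ x in (0:ℝ)..1, φ' x ^ 2 := by
  have hlim : Tendsto (fun c : ℝ => c ^ 2 * ∫ x in (0:ℝ)..1, φ x ^ 2) (𝓝[<] (Real.pi / 2))
      (𝓝 ((Real.pi / 2) ^ 2 * ∫ x in (0:ℝ)..1, φ x ^ 2)) :=
    ((continuous_id.pow 2).mul continuous_const).continuousAt.tendsto.mono_left
      nhdsWithin_le_nhds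
  refine le_of_tendsto hlim ?_
  filter_upwards [Ioo_mem_nhdsLT Real.pi_div_two_pos] with c hc
  exact sq_mul_integral_sq_le_integral_deriv_sq_of_lt hc.1.le hc.2 hderiv hcont h0


/-- Coercivity of the bilinear form `C(φ,φ) = ∫₀¹ φ'² − k φ(1)²` on `H¹_L(0,1)`:
for `|k| < 1` and `φ` continuously differentiable with `φ 0 = 0`,
`∫₀¹ φ'² − k φ(1)² ≥ (1−|k|) ∫₀¹ φ'²`, and consequently
`∫₀¹ φ'² − k φ(1)² ≥ ((1−|k|)π²/(π²+4)) (∫₀¹ φ² + ∫₀¹ φ'²)`. -/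
theorem stmt_8 (k : ℝ) (hk : |k| < 1) (φ φ' : ℝ → ℝ)
    (hderiv : ∀ x ∈ Set.Icc (0:ℝ) 1, HasDerivAt φ (φ' x) x)
    (hcont : ContinuousOn φ' (Set.Icc 0 1))
    (h0 : φ 0 = 0) :
    (∫ x in (0:ℝ)..1, φ' x ^ 2) - k * φ 1 ^ 2
      ≥ (1 - |k|) * ∫ x in (0:ℝ)..1, φ' x ^ 2 ∧
    (∫ x in (0:ℝ)..1, φ' x ^ 2) - k * φ 1 ^ 2
      ≥ (1 - |k|) * Real.pi ^ 2 / (Real.pi ^ 2 + 4) *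
          ((∫ x in (0:ℝ)..1, φ x ^ 2) + ∫ x in (0:ℝ)..1, φ' x ^ 2) := by
  have htrace := sq_apply_one_le_integral_deriv_sq hderiv hcont h0
  have hpoincare := pi_div_two_sq_mul_integral_sq_le_integral_deriv_sq hderiv hcont h0
  set A := ∫ x in (0:ℝ)..1, φ' x ^ 2
  set B := ∫ x in (0:ℝ)..1, φ x ^ 2
  have hcoercive : (1 - |k|) * A ≤ A - k * φ 1 ^ 2 := by
    have hk_le : k * φ 1 ^ 2 ≤ |k| * A :=
      mul_le_mul (le_abs_self k) htrace (sq_nonneg _) (abs_nonneg k)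
    linarith
  refine ⟨hcoercive, le_trans ?_ hcoercive⟩
  have hpi : 0 < Real.pi ^ 2 + 4 := by positivity
  rw [mul_div_assoc, mul_assoc]
  refine mul_le_mul_of_nonneg_left ?_ (by linarith)
  rw [div_mul_eq_mul_div, div_le_iff₀ hpi]
  linarith
end

section
/- Let c ≥ π²/8 and let ψ : [0,1] → ℝ be continuously differentiable. Then ∫₀¹ ψ'(x)² dx + c·ψ(0)² ≥ (1/2) (∫₀¹ ψ'(x)² dx + ∫₀¹ ψ(x)² dx). -/
/-- A Wirtinger-type inequality on `[0, 1]`, obtained by integrating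
`(ψ' x - tan (1 - x) * ψ x) ^ 2 ≥ 0`. -/
theorem integral_sq_le_integral_deriv_sq_add_tan_one {ψ ψ' : ℝ → ℝ}
    (hderiv : ∀ x ∈ Set.Icc (0:ℝ) 1, HasDerivAt ψ (ψ' x) x)
    (hcont : ContinuousOn ψ' (Set.Icc 0 1)) :
    ∫ x in (0:ℝ)..1, ψ x ^ 2 ≤ (∫ x in (0:ℝ)..1, ψ' x ^ 2) + Real.tan 1 * ψ 0 ^ 2 := by
  have hIcc : Set.uIcc (0:ℝ) 1 = Set.Icc 0 1 := Set.uIcc_of_le zero_le_one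
  have hcos : ∀ x ∈ Set.Icc (0:ℝ) 1, Real.cos (1 - x) ≠ 0 := fun x hx =>
    (Real.cos_pos_of_mem_Ioo ⟨by linarith [hx.2, Real.pi_pos],
      by linarith [hx.1, Real.pi_gt_three]⟩).ne'
  have htan : ∀ x ∈ Set.Icc (0:ℝ) 1,
      HasDerivAt (fun y => Real.tan (1 - y)) (-(1 + Real.tan (1 - x) ^ 2)) x := by
    intro x hx
    have h := (Real.hasDerivAt_tan (hcos x hx)).comp x ((hasDerivAt_id x).const_sub 1)
    refine h.congr_deriv ?_
    have hc := hcos x hx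
    rw [Real.tan_eq_sin_div_cos]
    field_simp
    linarith [Real.sin_sq_add_cos_sq (1 - x)]
  have hψ : ContinuousOn ψ (Set.Icc 0 1) := fun x hx =>
    (hderiv x hx).continuousAt.continuousWithinAt
  have ht : ContinuousOn (fun y => Real.tan (1 - y)) (Set.Icc 0 1) := fun x hx =>
    (htan x hx).continuousAt.continuousWithinAt
  have hF : ∀ x ∈ Set.uIcc (0:ℝ) 1, HasDerivAt (fun y => Real.tan (1 - y) * ψ y ^ 2)
      (-(1 + Real.tan (1 - x) ^ 2) * ψ x ^ 2 + Real.tan (1 - x) * (2 * ψ x * ψ' x)) x := by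
    intro x hx
    rw [hIcc] at hx
    exact ((htan x hx).mul ((hderiv x hx).pow 2)).congr_deriv (by simp)
  have hFint : IntervalIntegrable (fun x => -(1 + Real.tan (1 - x) ^ 2) * ψ x ^ 2
      + Real.tan (1 - x) * (2 * ψ x * ψ' x)) MeasureTheory.volume 0 1 := by
    apply ContinuousOn.intervalIntegrable
    rw [hIcc]
    fun_prop
  have hψint : IntervalIntegrable (fun x => ψ x ^ 2) MeasureTheory.volume 0 1 :=
    ContinuousOn.intervalIntegrable (hIcc ▸ hψ.pow 2)
  have hψ'int : IntervalIntegrable (fun x => ψ' x ^ 2) MeasureTheory.volume 0 1 :=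
    ContinuousOn.intervalIntegrable (hIcc ▸ hcont.pow 2)
  have hmono := intervalIntegral.integral_mono_on zero_le_one hFint (hψ'int.sub hψint)
    fun x _ => by nlinarith [sq_nonneg (ψ' x - Real.tan (1 - x) * ψ x)]
  rw [intervalIntegral.integral_eq_sub_of_hasDerivAt hF hFint,
    intervalIntegral.integral_sub hψ'int hψint] at hmono
  simp only [sub_self, Real.tan_zero, zero_mul, sub_zero, zero_sub] at hmono
  linarith

theorem Real.tan_one_le_two : Real.tan 1 ≤ 2 := by
  have hcos : 1 / 2 ≤ Real.cos 1 := by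
    rw [← Real.cos_pi_div_three]
    exact Real.cos_le_cos_of_nonneg_of_le_pi zero_le_one
      (by linarith [Real.pi_pos]) (by linarith [Real.pi_gt_three])
  rw [Real.tan_eq_sin_div_cos, div_le_iff₀ (by linarith)]
  linarith [Real.sin_le_one 1]


/-- Coercivity of the bilinear form `B(ψ,ψ) = ∫₀¹ ψ'² + c ψ(0)²` on `H¹(0,1)`:
for `c ≥ π²/8` and `ψ` continuously differentiable,
`∫₀¹ ψ'² + c ψ(0)² ≥ (1/2)(∫₀¹ ψ'² + ∫₀¹ ψ²)`. -/
theorem stmt_9 (c : ℝ) (hc : Real.pi ^ 2 / 8 ≤ c) (ψ ψ' : ℝ → ℝ)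
    (hderiv : ∀ x ∈ Set.Icc (0:ℝ) 1, HasDerivAt ψ (ψ' x) x)
    (hcont : ContinuousOn ψ' (Set.Icc 0 1)) :
    (∫ x in (0:ℝ)..1, ψ' x ^ 2) + c * ψ 0 ^ 2
      ≥ (1/2) * ((∫ x in (0:ℝ)..1, ψ' x ^ 2) + ∫ x in (0:ℝ)..1, ψ x ^ 2) := by
  have h := integral_sq_le_integral_deriv_sq_add_tan_one hderiv hcont
  have hc' : Real.tan 1 ≤ 2 * c := by nlinarith [Real.pi_gt_three, Real.tan_one_le_two]
  have := mul_le_mul_of_nonneg_right hc' (sq_nonneg (ψ 0))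
  linarith
end

section
/- Let μ > 0 and a, b, c, d ∈ ℝ satisfy: 3 e^{2μ}(1−a)² ≤ (1+a)² (i.e. q(a,μ) := −(3/2)e^{μ}(1−a)² + (1/2)e^{−μ}(1+a)² ≥ 0), d² e^{μ} ≤ 4μ, and 1 + 2(sinh μ + 2 cosh μ) b² ≤ c. Let u : [0,1] → ℝ be twice continuously differentiable, v : [0,1] → ℝ continuously differentiable and p : [0,1] → ℝ twice continuously differentiable, with u(0) = 0, v(0) = 0, u'(1) = −a·v(1) + b·p(0), p'(0) = c·p(0) and p'(1) = d·u(1). Then 2∫₀¹ [e^{μx}(u'(x)+v(x))(u''(x)+v'(x)) + e^{−μx}(u'(x)−v(x))(v'(x)−u''(x))] dx + ∫₀¹ p(x)·p''(x) dx ≤ 0. -/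
/-- The endpoint inequality to which the dissipativity estimate reduces after integration. -/
theorem boundary_form_nonpos (μ a b c d y P Q U : ℝ)
    (hq : 3 * Real.exp (2 * μ) * (1 - a) ^ 2 ≤ (1 + a) ^ 2)
    (hd : d ^ 2 * Real.exp μ ≤ 4 * μ)
    (hbc : 1 + 2 * (Real.sinh μ + 2 * Real.cosh μ) * b ^ 2 ≤ c) :
    Real.exp μ * ((1 - a) * y + b * P) ^ 2 - Real.exp (-μ) * (b * P - (1 + a) * y) ^ 2
      + d * U * Q - c * P ^ 2 - (Q - P) ^ 2 - 2 * μ * Real.exp (-μ) * U ^ 2 ≤ 0 := by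
  have hE : 0 < Real.exp μ := Real.exp_pos μ
  have hG : 0 < Real.exp (-μ) := Real.exp_pos (-μ)
  have hEG : Real.exp μ * Real.exp (-μ) = 1 := by rw [← Real.exp_add]; simp
  have hE2 : Real.exp (2 * μ) = Real.exp μ * Real.exp μ := by rw [← Real.exp_add]; ring_nf
  rw [Real.sinh_eq, Real.cosh_eq] at hbc
  rw [hE2] at hq
  generalize Real.exp μ = E at *
  generalize Real.exp (-μ) = G at *
  have hq' : 3 * E * (1 - a) ^ 2 ≤ G * (1 + a) ^ 2 := by
    have h := mul_le_mul_of_nonneg_left hq hG.le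
    linear_combination h - 3 * E * (1 - a) ^ 2 * hEG
  have hd' : d ^ 2 ≤ 4 * μ * G := by
    have h := mul_le_mul_of_nonneg_left hd hG.le
    linear_combination h - d ^ 2 * hEG
  have hc' : 1 + (3 * E + G) * b ^ 2 ≤ c := by linarith
  have hqy := mul_le_mul_of_nonneg_right hq' (sq_nonneg y)
  have hdU := mul_le_mul_of_nonneg_right hd' (sq_nonneg U)
  have hcP := mul_le_mul_of_nonneg_right hc' (sq_nonneg P)
  have hfE := mul_nonneg hE.le (sq_nonneg ((1 - a) * y - 2 * (b * P)))
  have hgG := mul_nonneg hG.le (sq_nonneg ((1 + a) * y - 2 * (b * P)))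
  linarith [sq_nonneg (Q - d * U), sq_nonneg (Q - 2 * P)]

/-- Lower bound for the weighted energy density by an affine function of `w`. -/
theorem affine_le_weighted_energy {μ x : ℝ} (hμ : 0 ≤ μ) (hx0 : 0 ≤ x) (hx1 : x ≤ 1)
    (w v m : ℝ) :
    2 * Real.exp (-μ) * (2 * m * w - m ^ 2) ≤
      Real.exp (μ * x) * (w + v) ^ 2 + Real.exp (-μ * x) * (w - v) ^ 2 := by
  have h1 : Real.exp (-μ) ≤ Real.exp (μ * x) :=
    Real.exp_le_exp.mpr (by nlinarith [mul_nonneg hμ hx0])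
  have h2 : Real.exp (-μ) ≤ Real.exp (-μ * x) := Real.exp_le_exp.mpr (by nlinarith)
  have h3 := mul_le_mul_of_nonneg_right h1 (sq_nonneg (w + v))
  have h4 := mul_le_mul_of_nonneg_right h2 (sq_nonneg (w - v))
  have h5 := mul_nonneg (Real.exp_pos (-μ)).le (sq_nonneg (w - m))
  have h6 := mul_nonneg (Real.exp_pos (-μ)).le (sq_nonneg v)
  linarith


/-- Dissipativity of the generator of the coupled wave–heat system: under the
parameter conditions `3e^{2μ}(1−a)² ≤ (1+a)²` (i.e. `q(a,μ) ≥ 0`), `d²e^{μ} ≤ 4μ` and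
`1 + 2(sinh μ + 2 cosh μ)b² ≤ c`, for smooth `(u,v,p)` in the domain of the generator
one has `(A_ε(u,v,p),(u,v,p))_ℋ ≤ 0`. -/
theorem stmt_10 (μ a b c d : ℝ) (hμ : 0 < μ)
    (hq : 3 * Real.exp (2 * μ) * (1 - a) ^ 2 ≤ (1 + a) ^ 2)
    (hd : d ^ 2 * Real.exp μ ≤ 4 * μ)
    (hbc : 1 + 2 * (Real.sinh μ + 2 * Real.cosh μ) * b ^ 2 ≤ c)
    (u u' u'' v v' p p' p'' : ℝ → ℝ)
    (hu1 : ∀ x ∈ Set.Icc (0:ℝ) 1, HasDerivAt u (u' x) x)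
    (hu2 : ∀ x ∈ Set.Icc (0:ℝ) 1, HasDerivAt u' (u'' x) x)
    (hu3 : ContinuousOn u'' (Set.Icc 0 1))
    (hv1 : ∀ x ∈ Set.Icc (0:ℝ) 1, HasDerivAt v (v' x) x)
    (hv2 : ContinuousOn v' (Set.Icc 0 1))
    (hp1 : ∀ x ∈ Set.Icc (0:ℝ) 1, HasDerivAt p (p' x) x)
    (hp2 : ∀ x ∈ Set.Icc (0:ℝ) 1, HasDerivAt p' (p'' x) x)
    (hp3 : ContinuousOn p'' (Set.Icc 0 1))
    (hu0 : u 0 = 0) (hv0 : v 0 = 0)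
    (hub : u' 1 = -a * v 1 + b * p 0)
    (hpb0 : p' 0 = c * p 0) (hpb1 : p' 1 = d * u 1) :
    2 * (∫ x in (0:ℝ)..1,
          (Real.exp (μ * x) * (u' x + v x) * (u'' x + v' x) +
            Real.exp (-μ * x) * (u' x - v x) * (v' x - u'' x)))
      + (∫ x in (0:ℝ)..1, p x * p'' x) ≤ 0 := by
  have hcu' : ContinuousOn u' (Set.Icc 0 1) := fun x hx => (hu2 x hx).continuousAt.continuousWithinAt
  have hcv : ContinuousOn v (Set.Icc 0 1) := fun x hx => (hv1 x hx).continuousAt.continuousWithinAt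
  have hcp : ContinuousOn p (Set.Icc 0 1) := fun x hx => (hp1 x hx).continuousAt.continuousWithinAt
  have hcA : ContinuousOn (fun x => Real.exp (μ * x) * (u' x + v x) * (u'' x + v' x) +
      Real.exp (-μ * x) * (u' x - v x) * (v' x - u'' x)) (Set.Icc 0 1) := by fun_prop
  have hcB : ContinuousOn (fun x => p x * p'' x) (Set.Icc 0 1) := by fun_prop
  rw [← intervalIntegral.integral_const_mul, ← intervalIntegral.integral_add
    ((hcA.intervalIntegrable_of_Icc zero_le_one).const_mul 2)
    (hcB.intervalIntegrable_of_Icc zero_le_one)]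
  have hF : ∀ x ∈ Set.Icc (0:ℝ) 1, HasDerivAt
      (fun x => Real.exp (μ * x) * (u' x + v x) ^ 2 - Real.exp (-μ * x) * (u' x - v x) ^ 2
        + p x * p' x - (2 * (p 1 - p 0) * p x - (p 1 - p 0) ^ 2 * x)
        - 2 * μ * Real.exp (-μ) * (2 * u 1 * u x - u 1 ^ 2 * x))
      (2 * (Real.exp (μ * x) * (u' x + v x) * (u'' x + v' x) +
            Real.exp (-μ * x) * (u' x - v x) * (v' x - u'' x)) + p x * p'' x
        + μ * (Real.exp (μ * x) * (u' x + v x) ^ 2 + Real.exp (-μ * x) * (u' x - v x) ^ 2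
          - 2 * Real.exp (-μ) * (2 * u 1 * u' x - u 1 ^ 2))
        + (p' x - (p 1 - p 0)) ^ 2) x := by
    intro x hx
    have he (k : ℝ) := ((hasDerivAt_id' x).const_mul k).exp
    have hf := (he μ).mul (((hu2 x hx).add (hv1 x hx)).pow 2)
    have hg := (he (-μ)).mul (((hu2 x hx).sub (hv1 x hx)).pow 2)
    have hp := ((hp1 x hx).const_mul (2 * (p 1 - p 0))).sub
      ((hasDerivAt_id' x).const_mul ((p 1 - p 0) ^ 2))
    have hu := (((hu1 x hx).const_mul (2 * u 1)).sub
      ((hasDerivAt_id' x).const_mul (u 1 ^ 2))).const_mul (2 * μ * Real.exp (-μ))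
    refine (((hf.sub hg).add ((hp1 x hx).mul (hp2 x hx))).sub hp |>.sub hu).congr_deriv ?_
    simp only [Pi.add_apply, Pi.sub_apply, Pi.pow_apply]
    push_cast
    ring
  refine (intervalIntegral.integral_le_sub_of_hasDeriv_right_of_le zero_le_one
    (fun x hx => (hF x hx).continuousAt.continuousWithinAt)
    (fun x hx => (hF x (Set.Ioo_subset_Icc_self hx)).hasDerivWithinAt)
    ((hcA.const_mul 2).add hcB).integrableOn_Icc ?_).trans ?_
  · intro x hx
    have h := mul_nonneg hμ.le (sub_nonneg.mpr
      (affine_le_weighted_energy hμ.le hx.1.le hx.2.le (u' x) (v x) (u 1)))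
    simp only [Pi.add_apply]
    linarith [sq_nonneg (p' x - (p 1 - p 0))]
  · have h := boundary_form_nonpos μ a b c d (v 1) (p 0) (p 1) (u 1) hq hd hbc
    simp only [hub, hpb0, hpb1, hu0, hv0, mul_one, mul_zero, Real.exp_zero]
    linarith
end

section
/- Let μ > 0 and a, k ∈ ℝ satisfy 2(sinh μ + 2 cosh μ) k² ≤ μ e^{−μ}. Let w : [0,1] → ℝ be twice continuously differentiable and z : [0,1] → ℝ continuously differentiable, with w(0) = 0, z(0) = 0 and w'(1) = −a·z(1) + k·w(1). Then ∫₀¹ [e^{μx}(z+w')(w''+z') + e^{−μx}(z−w')(w''−z')] dx ≤ −(μ/4) ∫₀¹ [e^{μx}(z+w')² + e^{−μx}(z−w')²] dx − (q(a,μ)/2)·z(1)², where q(a,μ) := −(3/2)e^{μ}(1−a)² + (1/2)e^{−μ}(1+a)². -/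
open intervalIntegral in
/-- Energy identity for a weighted pair of Riemann invariants on the unit interval. -/
theorem integral_weighted_flux (μ : ℝ) {p p' m m' : ℝ → ℝ}
    (hp : ∀ x ∈ Set.uIcc (0:ℝ) 1, HasDerivAt p (p' x) x)
    (hm : ∀ x ∈ Set.uIcc (0:ℝ) 1, HasDerivAt m (m' x) x)
    (hp' : ContinuousOn p' (Set.uIcc 0 1)) (hm' : ContinuousOn m' (Set.uIcc 0 1)) :
    (∫ x in (0:ℝ)..1,
        (Real.exp (μ * x) * p x * p' x - Real.exp (-μ * x) * m x * m' x))
      = (Real.exp μ * p 1 ^ 2 - Real.exp (-μ) * m 1 ^ 2) / 2 - (p 0 ^ 2 - m 0 ^ 2) / 2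
        - μ / 2 * ∫ x in (0:ℝ)..1,
            (Real.exp (μ * x) * p x ^ 2 + Real.exp (-μ * x) * m x ^ 2) := by
  have cp : ContinuousOn p (Set.uIcc 0 1) := fun x hx =>
    (hp x hx).continuousAt.continuousWithinAt
  have cm : ContinuousOn m (Set.uIcc 0 1) := fun x hx =>
    (hm x hx).continuousAt.continuousWithinAt
  have i1 : IntervalIntegrable (fun x => Real.exp (μ * x) * p x * p' x
      - Real.exp (-μ * x) * m x * m' x) MeasureTheory.volume 0 1 :=
    ContinuousOn.intervalIntegrable (by fun_prop)
  have i2 : IntervalIntegrable (fun x => Real.exp (μ * x) * p x ^ 2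
      + Real.exp (-μ * x) * m x ^ 2) MeasureTheory.volume 0 1 :=
    ContinuousOn.intervalIntegrable (by fun_prop)
  have exp_deriv (c x : ℝ) : HasDerivAt (fun y => Real.exp (c * y)) (Real.exp (c * x) * c) x := by
    simpa using ((hasDerivAt_id x).const_mul c).exp
  have ftc := integral_eq_sub_of_hasDerivAt
    (f := fun x => (Real.exp (μ * x) * p x ^ 2 - Real.exp (-μ * x) * m x ^ 2) / 2)
    (fun x hx => by
      refine ((((exp_deriv μ x).mul ((hp x hx).pow 2)).sub
        ((exp_deriv (-μ) x).mul ((hm x hx).pow 2))).div_const 2).congr_deriv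
        (g' := (Real.exp (μ * x) * p x * p' x - Real.exp (-μ * x) * m x * m' x)
          + μ / 2 * (Real.exp (μ * x) * p x ^ 2 + Real.exp (-μ * x) * m x ^ 2)) ?_
      simp only [Pi.pow_apply]
      ring)
    (i1.add (i2.const_mul _))
  rw [integral_add i1 (i2.const_mul _), integral_const_mul] at ftc
  simp only [mul_one, mul_zero, Real.exp_zero, one_mul] at ftc
  linarith

open intervalIntegral in
/-- A weighted Poincaré trace bound for the endpoint value of `w`. -/
theorem sq_le_integral_weighted_energy {μ : ℝ} (hμ : 0 ≤ μ) {w w' z : ℝ → ℝ}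
    (hw : ∀ x ∈ Set.uIcc (0:ℝ) 1, HasDerivAt w (w' x) x)
    (cw : ContinuousOn w' (Set.uIcc 0 1)) (cz : ContinuousOn z (Set.uIcc 0 1))
    (hw0 : w 0 = 0) :
    2 * Real.exp (-μ) * w 1 ^ 2 ≤ ∫ x in (0:ℝ)..1,
      (Real.exp (μ * x) * (z x + w' x) ^ 2 + Real.exp (-μ * x) * (z x - w' x) ^ 2) := by
  have iw : IntervalIntegrable w' MeasureTheory.volume 0 1 := cw.intervalIntegrable
  have ftc : ∫ x in (0:ℝ)..1, w' x = w 1 := by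
    rw [integral_eq_sub_of_hasDerivAt hw iw, hw0, sub_zero]
  have hlin : ∫ x in (0:ℝ)..1, 2 * Real.exp (-μ) * (2 * w 1 * w' x - w 1 ^ 2)
      = 2 * Real.exp (-μ) * w 1 ^ 2 := by
    rw [integral_const_mul, integral_sub (iw.const_mul _) intervalIntegrable_const,
      integral_const_mul, ftc, integral_const]
    simp only [sub_zero, one_smul]
    ring
  rw [← hlin]
  refine integral_mono_on zero_le_one (ContinuousOn.intervalIntegrable (by fun_prop))
    (ContinuousOn.intervalIntegrable (by fun_prop)) fun x hx => ?_
  have e1 : Real.exp (-μ) ≤ Real.exp (μ * x) := Real.exp_le_exp.2 (by nlinarith [hx.1])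
  have e2 : Real.exp (-μ) ≤ Real.exp (-μ * x) := Real.exp_le_exp.2 (by nlinarith [hx.2])
  calc 2 * Real.exp (-μ) * (2 * w 1 * w' x - w 1 ^ 2)
      ≤ 2 * Real.exp (-μ) * (z x ^ 2 + w' x ^ 2) := by
        gcongr
        nlinarith [sq_nonneg (w' x - w 1), sq_nonneg (z x)]
    _ = Real.exp (-μ) * (z x + w' x) ^ 2 + Real.exp (-μ) * (z x - w' x) ^ 2 := by ring
    _ ≤ _ := by gcongr

/-- Lyapunov dissipation for the reduced-order wave system: if
`2(sinh μ + 2 cosh μ) k² ≤ μ e^{−μ}`, `w(0) = z(0) = 0` and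
`w'(1) = −a z(1) + k w(1)`, then
`∫₀¹[e^{μx}(z+w')(w''+z') + e^{−μx}(z−w')(w''−z')]
  ≤ −(μ/4)∫₀¹[e^{μx}(z+w')² + e^{−μx}(z−w')²] − (q(a,μ)/2) z(1)²`
with `q(a,μ) = −(3/2)e^{μ}(1−a)² + (1/2)e^{−μ}(1+a)²`. -/
theorem stmt_12 (μ a k : ℝ) (hμ : 0 < μ)
    (hk : 2 * (Real.sinh μ + 2 * Real.cosh μ) * k ^ 2 ≤ μ * Real.exp (-μ))
    (w w' w'' z z' : ℝ → ℝ)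
    (hw1 : ∀ x ∈ Set.Icc (0:ℝ) 1, HasDerivAt w (w' x) x)
    (hw2 : ∀ x ∈ Set.Icc (0:ℝ) 1, HasDerivAt w' (w'' x) x)
    (hw3 : ContinuousOn w'' (Set.Icc 0 1))
    (hz1 : ∀ x ∈ Set.Icc (0:ℝ) 1, HasDerivAt z (z' x) x)
    (hz2 : ContinuousOn z' (Set.Icc 0 1))
    (hw0 : w 0 = 0) (hz0 : z 0 = 0)
    (hwb : w' 1 = -a * z 1 + k * w 1) :
    (∫ x in (0:ℝ)..1,
        (Real.exp (μ * x) * (z x + w' x) * (w'' x + z' x) +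
          Real.exp (-μ * x) * (z x - w' x) * (w'' x - z' x)))
      ≤ -(μ / 4) * (∫ x in (0:ℝ)..1,
            (Real.exp (μ * x) * (z x + w' x) ^ 2 + Real.exp (-μ * x) * (z x - w' x) ^ 2))
        - (-(3/2) * Real.exp μ * (1 - a) ^ 2 + (1/2) * Real.exp (-μ) * (1 + a) ^ 2) / 2
            * z 1 ^ 2 := by
  have huIcc : Set.uIcc (0:ℝ) 1 = Set.Icc 0 1 := Set.uIcc_of_le zero_le_one
  rw [← huIcc] at hw1 hw2 hw3 hz1 hz2
  have cw : ContinuousOn w' (Set.uIcc 0 1) := fun x hx =>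
    (hw2 x hx).continuousAt.continuousWithinAt
  have cz : ContinuousOn z (Set.uIcc 0 1) := fun x hx =>
    (hz1 x hx).continuousAt.continuousWithinAt
  have flux := integral_weighted_flux μ (p := fun x => z x + w' x) (m := fun x => z x - w' x)
    (fun x hx => (hz1 x hx).add (hw2 x hx)) (fun x hx => (hz1 x hx).sub (hw2 x hx))
    (hz2.add hw3) (hz2.sub hw3)
  have trace_bound := sq_le_integral_weighted_energy hμ.le hw1 cw cz hw0
  have integrand_eq : (fun x => Real.exp (μ * x) * (z x + w' x) * (w'' x + z' x) +
      Real.exp (-μ * x) * (z x - w' x) * (w'' x - z' x)) =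
      fun x => Real.exp (μ * x) * (z x + w' x) * (z' x + w'' x) -
      Real.exp (-μ * x) * (z x - w' x) * (z' x - w'' x) := by
    funext x
    ring
  rw [integrand_eq, flux]
  simp only [hz0, hwb]
  set I := ∫ x in (0:ℝ)..1,
    (Real.exp (μ * x) * (z x + w' x) ^ 2 + Real.exp (-μ * x) * (z x - w' x) ^ 2)
  rw [Real.sinh_eq, Real.cosh_eq] at hk
  have outgoing : Real.exp μ * (z 1 + (-a * z 1 + k * w 1)) ^ 2 ≤
      Real.exp μ * (3 / 2 * (1 - a) ^ 2 * z 1 ^ 2 + 3 * k ^ 2 * w 1 ^ 2) := by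
    gcongr
    nlinarith [sq_nonneg ((1 - a) * z 1 - 2 * (k * w 1))]
  have incoming : Real.exp (-μ) * ((1 + a) ^ 2 * z 1 ^ 2 / 2 - k ^ 2 * w 1 ^ 2) ≤
      Real.exp (-μ) * (z 1 - (-a * z 1 + k * w 1)) ^ 2 := by
    gcongr
    nlinarith [sq_nonneg ((1 + a) * z 1 - 2 * (k * w 1))]
  have hkw := mul_le_mul_of_nonneg_right hk (sq_nonneg (w 1))
  have hμI := mul_le_mul_of_nonneg_left trace_bound hμ.le
  linarith
end

section
/- Let c > 0 and let p : [0,1] → ℝ be twice continuously differentiable with p'(0) = c·p(0) and p'(1) = 0. Then ∫₀¹ p''(x)² dx ≥ (c π²/(4c + π²)) (∫₀¹ p'(x)² dx + c·p(0)²). -/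
open Set Filter Topology in
/-- Wirtinger's inequality on `[0,1]` for functions vanishing at the right endpoint, with a
subcritical constant. -/
lemma sq_mul_integral_sq_le_of_lt {q q' : ℝ → ℝ} {k : ℝ} (hk : 0 < k) (hk' : k < Real.pi / 2)
    (hq : ∀ x ∈ Icc (0:ℝ) 1, HasDerivAt q (q' x) x) (hq' : ContinuousOn q' (Icc 0 1))
    (h1 : q 1 = 0) :
    k ^ 2 * (∫ x in (0:ℝ)..1, q x ^ 2) ≤ ∫ x in (0:ℝ)..1, q' x ^ 2 := by
  have hI : uIcc (0:ℝ) 1 = Icc 0 1 := uIcc_of_le zero_le_one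
  have hqc : ContinuousOn q (Icc 0 1) := fun x hx => (hq x hx).continuousAt.continuousWithinAt
  have hcos : ∀ x ∈ Icc (0:ℝ) 1, Real.cos (k * x) ≠ 0 := fun x hx =>
    (Real.cos_pos_of_mem_Ioo ⟨by nlinarith [hx.1, Real.pi_pos], by nlinarith [hx.2]⟩).ne'
  set g : ℝ → ℝ := fun x => k * Real.tan (k * x) with hg
  have hgd : ∀ x ∈ Icc (0:ℝ) 1, HasDerivAt g (k ^ 2 + g x ^ 2) x := by
    intro x hx
    have h := ((Real.hasDerivAt_tan (hcos x hx)).comp x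
      ((hasDerivAt_id x).const_mul k)).const_mul k
    refine h.congr_deriv ?_
    have hc := hcos x hx
    simp only [hg, Real.tan_eq_sin_div_cos]
    field_simp
    nlinarith [Real.sin_sq_add_cos_sq (k * x)]
  have hgc : ContinuousOn g (Icc 0 1) := fun x hx => (hgd x hx).continuousAt.continuousWithinAt
  have hF : ∀ x ∈ uIcc (0:ℝ) 1, HasDerivAt (fun x => g x * q x ^ 2)
      ((k ^ 2 + g x ^ 2) * q x ^ 2 + g x * (2 * q x * q' x)) x := by
    intro x hx
    rw [hI] at hx
    refine ((hgd x hx).mul ((hq x hx).pow 2)).congr_deriv ?_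
    simp
  have hFc : ContinuousOn (fun x => (k ^ 2 + g x ^ 2) * q x ^ 2 + g x * (2 * q x * q' x))
      (uIcc (0:ℝ) 1) := by
    rw [hI]; fun_prop
  have hFint := intervalIntegral.integral_eq_sub_of_hasDerivAt hF hFc.intervalIntegrable
  have hzero : g 1 * q 1 ^ 2 - g 0 * q 0 ^ 2 = 0 := by simp [hg, h1]
  rw [hzero] at hFint
  have hqi : IntervalIntegrable (fun x => k ^ 2 * q x ^ 2) MeasureTheory.volume 0 1 := by
    apply ContinuousOn.intervalIntegrable
    rw [hI]; fun_prop
  have hq'i : IntervalIntegrable (fun x => q' x ^ 2) MeasureTheory.volume 0 1 := by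
    apply ContinuousOn.intervalIntegrable
    rw [hI]; fun_prop
  have hmono := intervalIntegral.integral_mono_on zero_le_one hqi
    (hq'i.add hFc.intervalIntegrable)
    (fun x _ => by nlinarith [sq_nonneg (q' x + g x * q x)])
  rw [intervalIntegral.integral_add hq'i hFc.intervalIntegrable, hFint, add_zero,
    intervalIntegral.integral_const_mul] at hmono
  exact hmono

open Set Filter Topology in
/-- Wirtinger's inequality on `[0,1]` for functions vanishing at the right endpoint. -/
lemma pi_div_two_sq_mul_integral_sq_le {q q' : ℝ → ℝ}
    (hq : ∀ x ∈ Icc (0:ℝ) 1, HasDerivAt q (q' x) x) (hq' : ContinuousOn q' (Icc 0 1))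
    (h1 : q 1 = 0) :
    (Real.pi / 2) ^ 2 * (∫ x in (0:ℝ)..1, q x ^ 2) ≤ ∫ x in (0:ℝ)..1, q' x ^ 2 := by
  have ht : Tendsto (fun k : ℝ => k ^ 2 * (∫ x in (0:ℝ)..1, q x ^ 2)) (𝓝[<] (Real.pi / 2))
      (𝓝 ((Real.pi / 2) ^ 2 * (∫ x in (0:ℝ)..1, q x ^ 2))) :=
    (Continuous.tendsto (by fun_prop) _).mono_left nhdsWithin_le_nhds
  refine le_of_tendsto ht ?_
  filter_upwards [Ioo_mem_nhdsLT Real.pi_div_two_pos] with k hk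
  exact sq_mul_integral_sq_le_of_lt hk.1 hk.2 hq hq' h1

open Set in
/-- A function on `[0,1]` vanishing at `1` satisfies `q(0)² ≤ ∫₀¹ q'²`. -/
lemma sq_apply_zero_le_integral_deriv_sq {q q' : ℝ → ℝ}
    (hq : ∀ x ∈ Icc (0:ℝ) 1, HasDerivAt q (q' x) x) (hq' : ContinuousOn q' (Icc 0 1))
    (h1 : q 1 = 0) :
    q 0 ^ 2 ≤ ∫ x in (0:ℝ)..1, q' x ^ 2 := by
  have hI : uIcc (0:ℝ) 1 = Icc 0 1 := uIcc_of_le zero_le_one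
  rw [← hI] at hq hq'
  have hint := intervalIntegral.integral_eq_sub_of_hasDerivAt hq hq'.intervalIntegrable
  have hmono := intervalIntegral.integral_mono_on (μ := MeasureTheory.volume)
    (f := fun x => -(2 * q 0) * q' x - q 0 ^ 2)
    (g := fun x => q' x ^ 2) zero_le_one
    ((hq'.intervalIntegrable.const_mul _).sub intervalIntegrable_const)
    (hq'.pow 2).intervalIntegrable
    (fun x _ => by nlinarith [sq_nonneg (q' x + q 0)])
  rw [intervalIntegral.integral_sub (hq'.intervalIntegrable.const_mul _) intervalIntegrable_const,
    intervalIntegral.integral_const_mul, hint, h1, intervalIntegral.integral_const] at hmono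
  simp only [smul_eq_mul] at hmono
  linarith


/-- Dissipation of the boundary-layer heat system in `H¹`: if `c > 0` and `p` is twice
continuously differentiable with `p'(0) = c p(0)` and `p'(1) = 0`, then
`∫₀¹ p''² ≥ (cπ²/(4c+π²)) (∫₀¹ p'² + c p(0)²)`. -/
theorem stmt_14 (c : ℝ) (hc : 0 < c) (p p' p'' : ℝ → ℝ)
    (hp1 : ∀ x ∈ Set.Icc (0:ℝ) 1, HasDerivAt p (p' x) x)
    (hp2 : ∀ x ∈ Set.Icc (0:ℝ) 1, HasDerivAt p' (p'' x) x)
    (hp3 : ContinuousOn p'' (Set.Icc 0 1))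
    (hb0 : p' 0 = c * p 0) (hb1 : p' 1 = 0) :
    (∫ x in (0:ℝ)..1, p'' x ^ 2)
      ≥ c * Real.pi ^ 2 / (4 * c + Real.pi ^ 2) *
          ((∫ x in (0:ℝ)..1, p' x ^ 2) + c * p 0 ^ 2) := by
  have hW := pi_div_two_sq_mul_integral_sq_le hp2 hp3 hb1
  have hT := sq_apply_zero_le_integral_deriv_sq hp2 hp3 hb1
  rw [hb0] at hT
  have hpi := Real.pi_pos
  rw [ge_iff_le, div_mul_eq_mul_div, div_le_iff₀ (by positivity)]
  have h1 := mul_le_mul_of_nonneg_left hW (by positivity : (0:ℝ) ≤ 4 * c)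
  have h2 := mul_le_mul_of_nonneg_left hT (by positivity : (0:ℝ) ≤ Real.pi ^ 2)
  linarith
end

section
/- Let μ > 0 and a, k, b, P ∈ ℝ. Let w : [0,1] → ℝ be twice continuously differentiable and z : [0,1] → ℝ continuously differentiable, with w(0) = 0, z(0) = 0 and w'(1) = −a·z(1) + k·w(1) + b·P. Then ∫₀¹ [e^{μx}(z+w')(w''+z') + e^{−μx}(z−w')(w''−z')] dx ≤ −(μ/4) ∫₀¹ [e^{μx}(z+w')² + e^{−μx}(z−w')²] dx − (q(a,μ)/2)·z(1)² + (2(sinh μ + 2 cosh μ) k² − (μ/2) e^{−μ})·w(1)² + 2(sinh μ + 2 cosh μ) b²·P², where q(a,μ) := −(3/2)e^{μ}(1−a)² + (1/2)e^{−μ}(1+a)². -/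
open Set Real

/-- Cauchy–Schwarz lower bound for the exponentially weighted energy by the boundary value. -/
theorem exp_mul_sq_le_integral_weighted_energy {μ : ℝ} (hμ : 0 ≤ μ) {w w' z : ℝ → ℝ}
    (hw : ∀ x ∈ Icc (0:ℝ) 1, HasDerivAt w (w' x) x) (hw' : ContinuousOn w' (Icc 0 1))
    (hz : ContinuousOn z (Icc 0 1)) (hw0 : w 0 = 0) :
    2 * exp (-μ) * w 1 ^ 2 ≤
      ∫ x in (0:ℝ)..1, (exp (μ * x) * (z x + w' x) ^ 2 + exp (-μ * x) * (z x - w' x) ^ 2) := by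
  have hcint : ContinuousOn (fun x => 2 * exp (-μ) * (2 * w 1 * w' x - w 1 ^ 2)) (uIcc 0 1) := by
    rw [uIcc_of_le zero_le_one]; fun_prop
  have hlower : ∫ x in (0:ℝ)..1, 2 * exp (-μ) * (2 * w 1 * w' x - w 1 ^ 2)
      = 2 * exp (-μ) * w 1 ^ 2 := by
    rw [intervalIntegral.integral_eq_sub_of_hasDerivAt
      (f := fun x => 2 * exp (-μ) * (2 * w 1 * w x - w 1 ^ 2 * x)) ?_ hcint.intervalIntegrable]
    · simp only [hw0]; ring
    · intro x hx
      rw [uIcc_of_le zero_le_one] at hx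
      exact ((((hw x hx).const_mul (2 * w 1)).sub
        ((hasDerivAt_id x).const_mul (w 1 ^ 2))).const_mul (2 * exp (-μ))).congr_deriv (by ring)
  rw [← hlower]
  refine intervalIntegral.integral_mono_on zero_le_one hcint.intervalIntegrable
    (ContinuousOn.intervalIntegrable (by rw [uIcc_of_le zero_le_one]; fun_prop)) fun x hx => ?_
  have h₁ : exp (-μ) ≤ exp (μ * x) := exp_le_exp.2 (by nlinarith [hx.1])
  have h₂ : exp (-μ) ≤ exp (-μ * x) := exp_le_exp.2 (by nlinarith [hx.2])
  have h₃ : 2 * w 1 * w' x - w 1 ^ 2 ≤ z x ^ 2 + w' x ^ 2 := by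
    nlinarith [sq_nonneg (w' x - w 1), sq_nonneg (z x)]
  calc 2 * exp (-μ) * (2 * w 1 * w' x - w 1 ^ 2)
      ≤ 2 * exp (-μ) * (z x ^ 2 + w' x ^ 2) := by gcongr
    _ = exp (-μ) * (z x + w' x) ^ 2 + exp (-μ) * (z x - w' x) ^ 2 := by ring
    _ ≤ _ := by gcongr

/-- Integration by parts for the derivative of the weighted energy along the wave equation. -/
theorem integral_weighted_energy_deriv (μ : ℝ) {v v' z z' : ℝ → ℝ}
    (hv : ∀ x ∈ Icc (0:ℝ) 1, HasDerivAt v (v' x) x) (hv' : ContinuousOn v' (Icc 0 1))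
    (hz : ∀ x ∈ Icc (0:ℝ) 1, HasDerivAt z (z' x) x) (hz' : ContinuousOn z' (Icc 0 1))
    (hz0 : z 0 = 0) :
    ∫ x in (0:ℝ)..1, (exp (μ * x) * (z x + v x) * (v' x + z' x) +
        exp (-μ * x) * (z x - v x) * (v' x - z' x)) =
      exp μ / 2 * (z 1 + v 1) ^ 2 - exp (-μ) / 2 * (z 1 - v 1) ^ 2 -
        μ / 2 * ∫ x in (0:ℝ)..1,
          (exp (μ * x) * (z x + v x) ^ 2 + exp (-μ * x) * (z x - v x) ^ 2) := by
  have hvc : ContinuousOn v (Icc 0 1) := fun x hx => (hv x hx).continuousAt.continuousWithinAt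
  have hzc : ContinuousOn z (Icc 0 1) := fun x hx => (hz x hx).continuousAt.continuousWithinAt
  have hD : IntervalIntegrable (fun x => exp (μ * x) * (z x + v x) * (v' x + z' x) +
      exp (-μ * x) * (z x - v x) * (v' x - z' x)) MeasureTheory.volume 0 1 :=
    ContinuousOn.intervalIntegrable (by rw [uIcc_of_le zero_le_one]; fun_prop)
  have hE : IntervalIntegrable (fun x => μ / 2 * (exp (μ * x) * (z x + v x) ^ 2 +
      exp (-μ * x) * (z x - v x) ^ 2)) MeasureTheory.volume 0 1 :=
    ContinuousOn.intervalIntegrable (by rw [uIcc_of_le zero_le_one]; fun_prop)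
  rw [eq_sub_iff_add_eq, ← intervalIntegral.integral_const_mul,
    ← intervalIntegral.integral_add hD hE,
    intervalIntegral.integral_eq_sub_of_hasDerivAt
      (f := fun x => exp (μ * x) / 2 * (z x + v x) ^ 2 - exp (-μ * x) / 2 * (z x - v x) ^ 2)
      ?_ (hD.add hE)]
  · simp [hz0]
  · intro x hx
    rw [uIcc_of_le zero_le_one] at hx
    have hexp (c : ℝ) : HasDerivAt (fun y => exp (c * y)) (exp (c * x) * (c * 1)) x :=
      ((hasDerivAt_id x).const_mul c).exp
    refine ((((hexp μ).div_const 2).mul (((hz x hx).add (hv x hx)).pow 2)).sub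
      (((hexp (-μ)).div_const 2).mul (((hz x hx).sub (hv x hx)).pow 2))).congr_deriv ?_
    simp only [Pi.add_apply, Pi.sub_apply, Pi.pow_apply]
    push_cast
    ring

/-- Lyapunov estimate for the wave component with perturbed boundary condition
`w'(1) = −a z(1) + k w(1) + b P`: for `μ > 0`,
`∫₀¹[e^{μx}(z+w')(w''+z') + e^{−μx}(z−w')(w''−z')]
  ≤ −(μ/4)∫₀¹[e^{μx}(z+w')² + e^{−μx}(z−w')²] − (q(a,μ)/2) z(1)²
    + (2(sinh μ + 2cosh μ)k² − (μ/2)e^{−μ}) w(1)² + 2(sinh μ + 2cosh μ)b² P²`,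
where `q(a,μ) = −(3/2)e^{μ}(1−a)² + (1/2)e^{−μ}(1+a)²`. -/
theorem stmt_17 (μ a k b P : ℝ) (hμ : 0 < μ)
    (w w' w'' z z' : ℝ → ℝ)
    (hw1 : ∀ x ∈ Set.Icc (0:ℝ) 1, HasDerivAt w (w' x) x)
    (hw2 : ∀ x ∈ Set.Icc (0:ℝ) 1, HasDerivAt w' (w'' x) x)
    (hw3 : ContinuousOn w'' (Set.Icc 0 1))
    (hz1 : ∀ x ∈ Set.Icc (0:ℝ) 1, HasDerivAt z (z' x) x)
    (hz2 : ContinuousOn z' (Set.Icc 0 1))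
    (hw0 : w 0 = 0) (hz0 : z 0 = 0)
    (hwb : w' 1 = -a * z 1 + k * w 1 + b * P) :
    (∫ x in (0:ℝ)..1,
        (Real.exp (μ * x) * (z x + w' x) * (w'' x + z' x) +
          Real.exp (-μ * x) * (z x - w' x) * (w'' x - z' x)))
      ≤ -(μ / 4) * (∫ x in (0:ℝ)..1,
            (Real.exp (μ * x) * (z x + w' x) ^ 2 + Real.exp (-μ * x) * (z x - w' x) ^ 2))
        - (-(3/2) * Real.exp μ * (1 - a) ^ 2 + (1/2) * Real.exp (-μ) * (1 + a) ^ 2) / 2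
            * z 1 ^ 2
        + (2 * (Real.sinh μ + 2 * Real.cosh μ) * k ^ 2 - μ / 2 * Real.exp (-μ)) * w 1 ^ 2
        + 2 * (Real.sinh μ + 2 * Real.cosh μ) * b ^ 2 * P ^ 2 := by
  have hw'c : ContinuousOn w' (Set.Icc 0 1) :=
    fun x hx => (hw2 x hx).continuousAt.continuousWithinAt
  have hzc : ContinuousOn z (Set.Icc 0 1) :=
    fun x hx => (hz1 x hx).continuousAt.continuousWithinAt
  have hE := exp_mul_sq_le_integral_weighted_energy hμ.le hw1 hw'c hzc hw0
  rw [integral_weighted_energy_deriv μ hw2 hw3 hz1 hz2 hz0, hwb, sinh_eq, cosh_eq]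
  set E := ∫ x in (0:ℝ)..1, (exp (μ * x) * (z x + w' x) ^ 2 + exp (-μ * x) * (z x - w' x) ^ 2)
  have hf : (z 1 + (-a * z 1 + k * w 1 + b * P)) ^ 2 ≤
      3 / 2 * ((1 - a) * z 1) ^ 2 + 6 * ((k * w 1) ^ 2 + (b * P) ^ 2) := by
    linarith [sq_nonneg ((1 - a) * z 1 - 2 * (k * w 1 + b * P)), sq_nonneg (k * w 1 - b * P)]
  have hg : 1 / 2 * ((1 + a) * z 1) ^ 2 - 2 * ((k * w 1) ^ 2 + (b * P) ^ 2) ≤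
      (z 1 - (-a * z 1 + k * w 1 + b * P)) ^ 2 := by
    linarith [sq_nonneg ((1 + a) * z 1 - 2 * (k * w 1 + b * P)), sq_nonneg (k * w 1 - b * P)]
  linarith [mul_le_mul_of_nonneg_left hf (half_pos (exp_pos μ)).le,
    mul_le_mul_of_nonneg_left hg (half_pos (exp_pos (-μ))).le,
    mul_le_mul_of_nonneg_left hE (by positivity : 0 ≤ μ / 4)]
end

section
/- Let k ∈ ℝ with k ≠ 1, let f : [0,1] → ℝ be continuous and let r ∈ ℝ. Then there exists a unique twice continuously differentiable function u : [0,1] → ℝ such that u''(x) = f(x) for all x ∈ [0,1], u(0) = 0 and u'(1) = k·u(1) + r. -/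
theorem eq_left_of_hasDerivAt_zero {a b : ℝ} {w : ℝ → ℝ}
    (hw : ∀ x ∈ Set.Icc a b, HasDerivAt w 0 x) : ∀ x ∈ Set.Icc a b, w x = w a :=
  constant_of_has_deriv_right_zero (fun x hx => (hw x hx).continuousAt.continuousWithinAt)
    fun x hx => (hw x (Set.Ico_subset_Icc_self hx)).hasDerivWithinAt

/-- A continuous function on `[a, b]` is there the second derivative of a function vanishing
at `a`. -/
theorem exists_hasDerivAt_hasDerivAt_of_continuousOn {a b : ℝ} (hab : a ≤ b) {f : ℝ → ℝ}
    (hf : ContinuousOn f (Set.Icc a b)) :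
    ∃ G F : ℝ → ℝ, (∀ x, HasDerivAt G (F x) x) ∧
      (∀ x ∈ Set.Icc a b, HasDerivAt F (f x) x) ∧ G a = 0 := by
  have hg : Continuous (Set.IccExtend hab ((Set.Icc a b).domRestrict f)) :=
    hf.domRestrict.Icc_extend'
  have hF (x : ℝ) := hg.integral_hasStrictDerivAt a x |>.hasDerivAt
  have hFc := continuous_iff_continuousAt.2 fun x => (hF x).continuousAt
  refine ⟨_, _, fun x => (hFc.integral_hasStrictDerivAt a x).hasDerivAt, fun x hx => ?_,
    intervalIntegral.integral_same⟩
  simpa [Set.IccExtend_of_mem _ _ hx] using hF x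

/-- Unique solvability of the wave-component boundary value problem
`u'' = f`, `u 0 = 0`, `u'(1) = k u(1) + r` for `k ≠ 1`: there exists a twice
continuously differentiable solution on `[0,1]`, and any two solutions agree on `[0,1]`. -/
theorem stmt_18 (k : ℝ) (hk : k ≠ 1) (f : ℝ → ℝ)
    (hf : ContinuousOn f (Set.Icc 0 1)) (r : ℝ) :
    (∃ u u' : ℝ → ℝ,
      (∀ x ∈ Set.Icc (0:ℝ) 1, HasDerivAt u (u' x) x) ∧
      (∀ x ∈ Set.Icc (0:ℝ) 1, HasDerivAt u' (f x) x) ∧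
      u 0 = 0 ∧ u' 1 = k * u 1 + r) ∧
    (∀ u u' v v' : ℝ → ℝ,
      ((∀ x ∈ Set.Icc (0:ℝ) 1, HasDerivAt u (u' x) x) ∧
       (∀ x ∈ Set.Icc (0:ℝ) 1, HasDerivAt u' (f x) x) ∧
       u 0 = 0 ∧ u' 1 = k * u 1 + r) →
      ((∀ x ∈ Set.Icc (0:ℝ) 1, HasDerivAt v (v' x) x) ∧
       (∀ x ∈ Set.Icc (0:ℝ) 1, HasDerivAt v' (f x) x) ∧
       v 0 = 0 ∧ v' 1 = k * v 1 + r) →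
      ∀ x ∈ Set.Icc (0:ℝ) 1, u x = v x) := by
  have hk' : 1 - k ≠ 0 := sub_ne_zero.2 hk.symm
  constructor
  · obtain ⟨G, F, hG, hF, hG0⟩ := exists_hasDerivAt_hasDerivAt_of_continuousOn zero_le_one hf
    let c := (k * G 1 + r - F 1) / (1 - k)
    have hc : c * (1 - k) = k * G 1 + r - F 1 := div_mul_cancel₀ _ hk'
    refine ⟨fun x => G x + c * x, fun x => F x + c, fun x _ => ?_,
      fun x hx => (hF x hx).add_const c, by simp [hG0], by linear_combination hc⟩
    simpa using (hG x).fun_add ((hasDerivAt_id x).const_mul c)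
  · rintro u u' v v' ⟨hu, hu', hu0, hu1⟩ ⟨hv, hv', hv0, hv1⟩
    have hslope := eq_left_of_hasDerivAt_zero (w := fun x => u' x - v' x) fun x hx => by
      simpa using (hu' x hx).fun_sub (hv' x hx)
    have hlin := eq_left_of_hasDerivAt_zero (w := fun x => u x - v x - (u' 0 - v' 0) * x)
      fun x hx => by
        have h := ((hu x hx).sub (hv x hx)).sub
          ((hasDerivAt_id x).const_mul (u' 0 - v' 0))
        rw [mul_one, hslope x hx, sub_self] at h
        exact h
    have hs1 := hslope 1 (by simp)
    have hl1 := hlin 1 (by simp)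
    have ha : u' 0 - v' 0 = 0 := by
      refine (mul_eq_zero.1 ?_).resolve_right hk'
      linear_combination hu1 - hv1 - hs1 + k * hl1 + k * hu0 - k * hv0
    intro x hx
    linear_combination hlin x hx + hu0 - hv0 + x * ha
end
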